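/- (Weighted integration by parts for the weight |x-x₀|^{2β}.) Let A = {x ∈ ℝ² : R₂ < |x| < R₁} with 1/2 ≤ R₂ < R₁ ≤ 1, let β ∈ (-1/2, ∞), x₀ ∈ C(1/2), let V ∈ C¹(closure(A)) and u ∈ C¹(closure(A)). Then ∫_A −|x-x₀|^{2β} V(x) [(x-x₀)·∇(e^{u})(x)] dx = ∫_A 2(β+1)|x-x₀|^{2β} V(x) e^{u(x)} dx + ∫_A |x-x₀|^{2β} [(x-x₀)·∇V(x)] e^{u(x)} dx − ∫_{∂A} |x-x₀|^{2β} [(x-x₀)·ν(x)] V(x) e^{u(x)} dσ(x), where ν is the outward unit normal of A and dσ is arc-length measure on ∂A. -/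

import Mathlib

open MeasureTheory Real RealInnerProductSpace

noncomputable section

/-- The Euclidean plane ℝ². -/
abbrev E2 := EuclideanSpace ℝ (Fin 2)

/-- The open annulus `{x : R₂ < |x| < R₁}` centered at the origin. -/
def ann (R₂ R₁ : ℝ) : Set E2 := {x : E2 | R₂ < ‖x‖ ∧ ‖x‖ < R₁}

/-- `Ω`, the open annulus of radii 1/2 and 1 centered at the origin. -/
def Omega : Set E2 := ann (1/2) 1

/-- The Laplacian `Δ = ∂₁₁ + ∂₂₂` on ℝ². -/
def lap (u : E2 → ℝ) (x : E2) : ℝ :=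
  ∑ i : Fin 2,
    iteratedFDeriv ℝ 2 u x ![EuclideanSpace.single i 1, EuclideanSpace.single i 1]

/-- The point `r (cos θ, sin θ)` on the circle of radius `r`. -/
def circlePt (r θ : ℝ) : E2 :=
  (WithLp.equiv 2 (Fin 2 → ℝ)).symm ![r * Real.cos θ, r * Real.sin θ]

/-- Arc-length integral of `f` over the circle `C(r) = {x : |x| = r}` centered at the origin:
`∫_{C(r)} f dσ = ∫_0^{2π} f(r cos θ, r sin θ) r dθ`. -/
def circleIntR (f : E2 → ℝ) (r : ℝ) : ℝ := ∫ θ in (0:ℝ)..(2 * π), f (circlePt r θ) * r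

/-- A classical solution of problem (P): `u ∈ C²(closure Ω)`, `u = 0` on `∂Ω`, and
`-Δu = (1 + |x - x₀|^{2β}) V e^u` in `Ω`. -/
def IsSolP (β : ℝ) (x₀ : E2) (V u : E2 → ℝ) : Prop :=
  ContDiffOn ℝ 2 u (closure Omega) ∧
  (∀ x ∈ frontier Omega, u x = 0) ∧
  ∀ x ∈ Omega, -lap u x = (1 + ‖x - x₀‖ ^ (2 * β)) * V x * Real.exp (u x)

/-- A classical solution of problem (P_β): `u ∈ C²(closure Ω)`, `u = 0` on `∂Ω`, and
`-Δu = |x - x₀|^{2β} V e^u` in `Ω`. -/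
def IsSolPbeta (β : ℝ) (x₀ : E2) (V u : E2 → ℝ) : Prop :=
  ContDiffOn ℝ 2 u (closure Omega) ∧
  (∀ x ∈ frontier Omega, u x = 0) ∧
  ∀ x ∈ Omega, -lap u x = ‖x - x₀‖ ^ (2 * β) * V x * Real.exp (u x)

open Set Filter Topology in
/-- bounded derivative -/
lemma aux_bdd (s : Set E2) (hs : IsOpen s) (hc : IsCompact (closure s)) (V : E2 → ℝ)
    (hV : ContDiffOn ℝ 1 V (closure s)) : ∃ C : ℝ, ∀ x ∈ s, ‖fderiv ℝ V x‖ ≤ C := by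
  have key : ∃ C : ℝ, ∀ x ∈ closure s, x ∈ s → ‖fderiv ℝ V x‖ ≤ C := by
    refine hc.induction_on (p := fun t => ∃ C : ℝ, ∀ x ∈ t, x ∈ s → ‖fderiv ℝ V x‖ ≤ C)
      ⟨0, by simp⟩ ?_ ?_ ?_
    · rintro t t' htt ⟨C, hC⟩
      exact ⟨C, fun x hx => hC x (htt hx)⟩
    · rintro t t' ⟨C, hC⟩ ⟨C', hC'⟩
      refine ⟨max C C', ?_⟩
      rintro x (hx | hx) hxs
      · exact (hC x hx hxs).trans (le_max_left _ _)
      · exact (hC' x hx hxs).trans (le_max_right _ _)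
    · intro x hx
      have h := hV x hx
      rw [← zero_add (1 : WithTop ℕ∞), contDiffWithinAt_succ_iff_hasFDerivWithinAt' (by simp)] at h
      obtain ⟨w, hw, -, -, f', hf', hcf⟩ := h
      rw [insert_eq_of_mem hx] at hw
      have hb : ∀ᶠ y in 𝓝[closure s] x, ‖f' y‖ < ‖f' x‖ + 1 :=
        (hcf.continuousWithinAt.norm).eventually_lt continuousWithinAt_const (by simp)
      refine ⟨_, inter_mem hw hb, ‖f' x‖ + 1, ?_⟩
      rintro y ⟨hy, hy'⟩ hys
      have := (hf' y hy).hasFDerivAt (mem_of_superset (hs.mem_nhds hys) subset_closure)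
      rw [this.fderiv]
      exact le_of_lt hy'
  obtain ⟨C, hC⟩ := key
  exact ⟨C, fun x hx => hC x (subset_closure hx) hx⟩

lemma ann_isOpen (R₂ R₁ : ℝ) : IsOpen (ann R₂ R₁) :=
  (isOpen_lt continuous_const continuous_norm).inter (isOpen_lt continuous_norm continuous_const)

lemma ann_compact (R₂ R₁ : ℝ) : IsCompact (closure (ann R₂ R₁)) := by
  refine Metric.isCompact_of_isClosed_isBounded isClosed_closure ?_
  refine Bornology.IsBounded.closure ?_
  refine (Metric.isBounded_ball (x := (0:E2)) (r := R₁)).subset ?_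
  intro x hx
  simpa using hx.2

lemma circlePt_zero' (r θ : ℝ) : circlePt r θ 0 = r * Real.cos θ := by simp [circlePt]
lemma circlePt_one' (r θ : ℝ) : circlePt r θ 1 = r * Real.sin θ := by simp [circlePt]

lemma inner_E2 (a b : E2) : ⟪a, b⟫ = a 0 * b 0 + a 1 * b 1 := by
  simp [PiLp.inner_apply, Fin.sum_univ_two, mul_comm]

lemma norm_circlePt (r θ : ℝ) (hr : 0 ≤ r) : ‖circlePt r θ‖ = r := by
  rw [EuclideanSpace.norm_eq, Fin.sum_univ_two, circlePt_zero', circlePt_one']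
  simp only [Real.norm_eq_abs, sq_abs]
  rw [show (r * Real.cos θ)^2 + (r * Real.sin θ)^2 = r^2 * (Real.sin θ ^2 + Real.cos θ^2) by ring,
    Real.sin_sq_add_cos_sq, mul_one, Real.sqrt_sq hr]

lemma continuous_circlePt : Continuous (fun p : ℝ × ℝ => circlePt p.1 p.2) := by
  unfold circlePt
  refine (PiLp.continuous_toLp 2 _).comp ?_
  refine continuous_pi fun i => ?_
  fin_cases i <;> simp <;> fun_prop

open Set in
lemma circlePt_mem_closure (R₂ R₁ : ℝ) (h0 : 0 ≤ R₂) (hR : R₂ < R₁) (r θ : ℝ)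
    (hr : r ∈ Icc R₂ R₁) : circlePt r θ ∈ closure (ann R₂ R₁) := by
  have hc : Continuous (fun t : ℝ => circlePt t θ) :=
    continuous_circlePt.comp (by fun_prop : Continuous (fun t : ℝ => (t, θ)))
  refine map_mem_closure (f := fun t : ℝ => circlePt t θ) (s := Ioo R₂ R₁) hc ?_ ?_
  · rw [closure_Ioo hR.ne]; exact hr
  · intro t ht
    have := norm_circlePt t θ (h0.trans ht.1.le)
    simp only [ann, Set.mem_ofPred_eq, this]
    exact ht

/-- the measurable equivalence between the product and the Euclidean plane -/
def eqv : (ℝ × ℝ) ≃ᵐ E2 := (MeasurableEquiv.finTwoArrow (α := ℝ)).symm.trans (MeasurableEquiv.toLp 2 (Fin 2 → ℝ))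

lemma eqv_mp : MeasurePreserving eqv :=
  (PiLp.volume_preserving_toLp (Fin 2)).comp ((volume_preserving_finTwoArrow ℝ).symm _)

lemma eqv_polar (p : ℝ × ℝ) : eqv (polarCoord.symm p) = circlePt p.1 p.2 := by
  ext i
  fin_cases i <;> simp [eqv, circlePt, MeasurableEquiv.finTwoArrow]

open Set in
lemma polar_int (R₂ R₁ : ℝ) (h0 : 0 ≤ R₂) (f : E2 → ℝ) :
    ∫ x in ann R₂ R₁, f x
      = ∫ p in Ioo R₂ R₁ ×ˢ Ioo (-π) π, p.1 * f (circlePt p.1 p.2) := by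
  rw [← integral_indicator (ann_isOpen R₂ R₁).measurableSet,
    ← eqv_mp.integral_comp eqv.measurableEmbedding, ← integral_comp_polarCoord_symm]
  simp only [eqv_polar, smul_eq_mul]
  have : ∀ p ∈ polarCoord.target, p.1 * (ann R₂ R₁).indicator f (circlePt p.1 p.2)
      = (Ioo R₂ R₁ ×ˢ Ioo (-π) π).indicator (fun p : ℝ × ℝ => p.1 * f (circlePt p.1 p.2)) p := by
    rintro p ⟨hp1, hp2⟩
    have hn := norm_circlePt p.1 p.2 (le_of_lt hp1)
    simp only [indicator, ann, mem_ofPred_eq, hn, mem_prod, hp2, and_true, mem_Ioo]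
    split_ifs <;> simp_all
  rw [setIntegral_congr_fun polarCoord.open_target.measurableSet this,
    setIntegral_indicator (measurableSet_Ioo.prod measurableSet_Ioo)]
  congr 2
  ext p
  simp only [polarCoord_target, mem_inter_iff, mem_prod, mem_Ioi, mem_Ioo]
  constructor
  · tauto
  · intro h
    exact ⟨⟨by linarith [h.1.1], h.2⟩, h⟩

open Set in
lemma polar_integrable (R₂ R₁ : ℝ) (h0 : 0 ≤ R₂) (f : E2 → ℝ) (hf : IntegrableOn f (ann R₂ R₁)) :
    IntegrableOn (fun p : ℝ × ℝ => p.1 * f (circlePt p.1 p.2)) (Ioo R₂ R₁ ×ˢ Ioo (-π) π) := by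
  rw [← integrable_indicator_iff (ann_isOpen R₂ R₁).measurableSet,
    ← eqv_mp.integrable_comp_emb eqv.measurableEmbedding] at hf
  have h1 := hf.integrableOn (s := polarCoord.symm '' (Ioo R₂ R₁ ×ˢ Ioo (-π) π))
  have hsub : Ioo R₂ R₁ ×ˢ Ioo (-π) π ⊆ polarCoord.target := by
    rintro p ⟨h1, h2⟩
    exact ⟨lt_of_le_of_lt h0 h1.1, h2⟩
  rw [integrableOn_image_iff_integrableOn_abs_det_fderiv_smul volume
    (measurableSet_Ioo.prod measurableSet_Ioo)
    (fun p _ => (hasFDerivAt_polarCoord_symm p).hasFDerivWithinAt)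
    (polarCoord.symm.injOn.mono hsub)] at h1
  refine h1.congr_fun ?_ (measurableSet_Ioo.prod measurableSet_Ioo)
  rintro p hp
  have hp0 : 0 < p.1 := (hsub hp).1
  have hn := norm_circlePt p.1 p.2 hp0.le
  have hm : circlePt p.1 p.2 ∈ ann R₂ R₁ := by
    simp only [ann, mem_ofPred_eq, hn]; exact hp.1
  simp only [det_fderivPolarCoordSymm, Function.comp, eqv_polar, indicator_of_mem hm,
    abs_of_pos hp0, smul_eq_mul]

lemma w_integrable (R₂ R₁ β : ℝ) (hβ : -(1/2) < β) (x₀ : E2) :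
    IntegrableOn (fun x => ‖x - x₀‖ ^ (2 * β)) (ann R₂ R₁) := by
  have hm : Measurable (fun x : E2 => ‖x‖ ^ (2 * β)) := by fun_prop
  have hl : LocallyIntegrable (fun x : E2 => ‖x‖ ^ (2 * β)) := by
    refine locallyIntegrable_of_norm_le_rpow (C := 1) (α := -(2 * β)) (by simp) ?_ ?_
      hm.aestronglyMeasurable
    · simp; linarith
    · refine Filter.Eventually.of_forall fun x => ?_
      rw [one_mul, neg_neg, Real.norm_of_nonneg (by positivity)]
  have hc : IsCompact ((fun x => x - x₀) '' closure (ann R₂ R₁)) :=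
    (ann_compact R₂ R₁).image (by fun_prop)
  have := hl.integrableOn_isCompact hc
  have hmp : MeasurePreserving (fun x : E2 => x - x₀) := measurePreserving_sub_right volume x₀
  rw [hmp.integrableOn_image (MeasurableEquiv.subRight x₀).measurableEmbedding] at this
  exact this.mono_set subset_closure

lemma Phi_cont (β : ℝ) (hβ : -(1/2) < β) (x₀ : E2) :
    Continuous (fun x : E2 => ‖x - x₀‖ ^ (2 * β) • (x - x₀)) := by
  suffices h : Continuous (fun x : E2 => ‖x‖ ^ (2 * β) • x) from
    h.comp (by fun_prop : Continuous (fun x : E2 => x - x₀))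
  rw [continuous_iff_continuousAt]
  intro x
  by_cases hx : x = 0
  · subst hx
    have : Filter.Tendsto (fun x : E2 => ‖x‖ ^ (2 * β + 1)) (nhds 0) (nhds 0) := by
      have := (continuous_norm (E := E2)).continuousAt (x := 0) |>.rpow_const (p := 2 * β + 1) (Or.inr (by linarith))
      have h2 := this.tendsto
      simp only [norm_zero] at h2
      rwa [Real.zero_rpow (by linarith)] at h2
    unfold ContinuousAt
    simp only [smul_zero]
    refine squeeze_zero_norm (fun y => ?_) this
    rw [norm_smul, Real.norm_of_nonneg (by positivity)]
    by_cases hy : y = 0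
    · subst hy; simp; positivity
    · rw [Real.rpow_add_one (by simpa using hy)]
  · exact (continuous_norm.continuousAt.rpow_const (Or.inl (by simpa using hx))).smul continuousAt_id

lemma K_deriv (β : ℝ) (x₀ x : E2) (hx : x ≠ x₀) (H : E2 → ℝ) (H' : E2 →L[ℝ] ℝ)
    (hH : HasFDerivAt H H' x) :
    ∃ K' : E2 →L[ℝ] ℝ, HasFDerivAt (fun y => ‖y - x₀‖ ^ (2 * β) * H y) K' x ∧
      K' (x - x₀) = 2 * β * ‖x - x₀‖ ^ (2 * β) * H x + ‖x - x₀‖ ^ (2 * β) * H' (x - x₀) := by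
  have hpos : 0 < ‖x - x₀‖ := norm_pos_iff.2 (sub_ne_zero.2 hx)
  have hw : (fun y : E2 => ‖y - x₀‖ ^ (2 * β)) = fun y => (‖y - x₀‖ ^ 2) ^ β := by
    funext y
    rw [Real.rpow_mul (norm_nonneg _), Real.rpow_two]
  have h1 : HasFDerivAt (fun y : E2 => ‖y - x₀‖ ^ 2) (2 • (innerSL ℝ (x - x₀))) x := by
    have := ((hasFDerivAt_id x).sub_const x₀).norm_sq
    simpa using this
  have h2 := h1.rpow_const (p := β) (Or.inl (by positivity))
  rw [← hw] at h2
  refine ⟨_, h2.mul hH, ?_⟩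
  have e : ‖x - x₀‖ ^ (2 * β) = (‖x - x₀‖ ^ 2) ^ (β - 1) * ‖x - x₀‖ ^ 2 := by
    rw [← Real.rpow_add_one (by positivity), sub_add_cancel, congrFun hw x]
  simp only [add_apply, smul_apply, innerSL_apply_apply,
    real_inner_self_eq_norm_sq, smul_eq_mul, nsmul_eq_mul]
  rw [e]
  push_cast
  ring

lemma circlePt_hasDerivAt_r (r θ : ℝ) :
    HasDerivAt (fun t => circlePt t θ) (circlePt 1 θ) r := by
  have h : (fun t => circlePt t θ) = fun t : ℝ => t • circlePt 1 θ := by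
    funext t
    ext i
    fin_cases i <;> simp [circlePt]
  rw [h]
  simpa using (hasDerivAt_id r).smul_const (circlePt 1 θ)

/-- rotated unit vector -/
def Qv (θ : ℝ) : E2 := (WithLp.equiv 2 (Fin 2 → ℝ)).symm ![- Real.sin θ, Real.cos θ]

lemma circlePt_hasDerivAt_θ (r θ : ℝ) :
    HasDerivAt (fun t => circlePt r t) (r • Qv θ) θ := by
  have h : (fun t => circlePt r t) = fun t : ℝ =>
      (r * Real.cos t) • circlePt 1 0 + (r * Real.sin t) • Qv 0 := by
    funext t
    ext i
    fin_cases i <;> simp [circlePt, Qv]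
  rw [h]
  have h2 := (((Real.hasDerivAt_cos θ).const_mul r).smul_const (circlePt 1 0)).add
    (((Real.hasDerivAt_sin θ).const_mul r).smul_const (Qv 0))
  refine h2.congr_deriv ?_
  ext i
  fin_cases i <;> simp [circlePt, Qv]

lemma circlePt_diff : Differentiable ℝ (fun p : ℝ × ℝ => circlePt p.1 p.2) := by
  rw [differentiable_euclidean]
  intro i
  fin_cases i <;> simp [circlePt] <;> fun_prop

/-- radial flux -/
def ff (K : E2 → ℝ) (x₀ : E2) (p : ℝ × ℝ) : ℝ :=
  K (circlePt p.1 p.2) * (p.1 ^ 2 - p.1 * (x₀ 0 * Real.cos p.2 + x₀ 1 * Real.sin p.2))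

/-- angular flux -/
def gg (K : E2 → ℝ) (x₀ : E2) (p : ℝ × ℝ) : ℝ :=
  K (circlePt p.1 p.2) * (x₀ 0 * Real.sin p.2 - x₀ 1 * Real.cos p.2)

lemma polar_div (K : E2 → ℝ) (K' : E2 →L[ℝ] ℝ) (x₀ : E2) (p : ℝ × ℝ)
    (hK : HasFDerivAt K K' (circlePt p.1 p.2)) :
    DifferentiableAt ℝ (ff K x₀) p ∧ DifferentiableAt ℝ (gg K x₀) p ∧
    fderiv ℝ (ff K x₀) p (1, 0) + fderiv ℝ (gg K x₀) p (0, 1) =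
      p.1 * (2 * K (circlePt p.1 p.2) + K' (circlePt p.1 p.2 - x₀)) := by
  have hc : DifferentiableAt ℝ (fun p : ℝ × ℝ => K (circlePt p.1 p.2)) p :=
    DifferentiableAt.comp p hK.differentiableAt (circlePt_diff p)
  have hf : DifferentiableAt ℝ (ff K x₀) p := hc.mul (by fun_prop)
  have hg : DifferentiableAt ℝ (gg K x₀) p := hc.mul (by fun_prop)
  refine ⟨hf, hg, ?_⟩
  obtain ⟨r, θ⟩ := p
  have f1 : HasDerivAt (fun t => ff K x₀ (t, θ)) (fderiv ℝ (ff K x₀) (r, θ) (1, 0)) r :=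
    HasFDerivAt.comp_hasDerivAt (f := fun t : ℝ => (t, θ)) r hf.hasFDerivAt ((hasDerivAt_id r).prodMk (hasDerivAt_const r θ))
  have g1 : HasDerivAt (fun t => gg K x₀ (r, t)) (fderiv ℝ (gg K x₀) (r, θ) (0, 1)) θ :=
    HasFDerivAt.comp_hasDerivAt (f := fun t : ℝ => (r, t)) θ hg.hasFDerivAt ((hasDerivAt_const θ r).prodMk (hasDerivAt_id θ))
  have f2 := (hK.comp_hasDerivAt r (circlePt_hasDerivAt_r r θ)).mul
    (((hasDerivAt_id r).pow 2).sub ((hasDerivAt_id r).mul_const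
      (x₀ 0 * Real.cos θ + x₀ 1 * Real.sin θ)))
  have g2 := (hK.comp_hasDerivAt θ (circlePt_hasDerivAt_θ r θ)).mul
    (((Real.hasDerivAt_sin θ).const_mul (x₀ 0)).sub ((Real.hasDerivAt_cos θ).const_mul (x₀ 1)))
  rw [f1.unique f2, g1.unique g2]
  have lin : circlePt r θ - x₀ = (r - (x₀ 0 * Real.cos θ + x₀ 1 * Real.sin θ)) • circlePt 1 θ
      + (x₀ 0 * Real.sin θ - x₀ 1 * Real.cos θ) • Qv θ := by
    ext i
    have := Real.sin_sq_add_cos_sq θ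
    fin_cases i <;> simp [circlePt, Qv]
    · linear_combination (x₀ 0) * this
    · linear_combination (x₀ 1) * this
  rw [lin]
  simp only [map_add, map_smul, smul_eq_mul, Function.comp, id]
  simp
  ring

open Set in
lemma div_thm (R₂ R₁ β : ℝ) (hR₂ : 1/2 ≤ R₂) (hR : R₂ < R₁)
    (hβ : -(1/2) < β) (x₀ : E2) (hx₀ : ‖x₀‖ = 1/2) (H : E2 → ℝ)
    (hH : ContDiffOn ℝ 1 H (closure (ann R₂ R₁)))
    (hi : IntegrableOn (fun x => 2 * (β + 1) * ‖x - x₀‖ ^ (2 * β) * H x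
      + ‖x - x₀‖ ^ (2 * β) * fderiv ℝ H x (x - x₀)) (ann R₂ R₁)) :
    ∫ x in ann R₂ R₁, (2 * (β + 1) * ‖x - x₀‖ ^ (2 * β) * H x
      + ‖x - x₀‖ ^ (2 * β) * fderiv ℝ H x (x - x₀)) =
    circleIntR (fun x => ‖x - x₀‖ ^ (2 * β) * ⟪x - x₀, R₁⁻¹ • x⟫ * H x) R₁
        + circleIntR (fun x => ‖x - x₀‖ ^ (2 * β) * ⟪x - x₀, -(R₂⁻¹ • x)⟫ * H x) R₂ := by
  have h0 : 0 ≤ R₂ := by linarith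
  set K : E2 → ℝ := fun y => ‖y - x₀‖ ^ (2 * β) * H y with hKdef
  have hpi : (-π) < π := by linarith [Real.pi_pos]
  -- fluxes through the vector field
  have hfeq : ∀ p, ff K x₀ p = H (circlePt p.1 p.2) *
      ⟪‖circlePt p.1 p.2 - x₀‖ ^ (2 * β) • (circlePt p.1 p.2 - x₀), circlePt p.1 p.2⟫ := by
    intro p
    rw [real_inner_smul_left, inner_E2]
    simp only [ff, hKdef, PiLp.sub_apply, circlePt_zero', circlePt_one']
    linear_combination (-‖circlePt p.1 p.2 - x₀‖ ^ (2 * β) * H (circlePt p.1 p.2) * p.1 ^ 2)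
      * Real.sin_sq_add_cos_sq p.2
  have hgeq : ∀ p, gg K x₀ p = H (circlePt p.1 p.2) *
      ⟪‖circlePt p.1 p.2 - x₀‖ ^ (2 * β) • (circlePt p.1 p.2 - x₀), Qv p.2⟫ := by
    intro p
    rw [real_inner_smul_left, inner_E2]
    simp only [gg, hKdef, PiLp.sub_apply, circlePt_zero', circlePt_one']
    simp [Qv]
    ring
  have hcQ : Continuous Qv := by
    unfold Qv
    refine (PiLp.continuous_toLp 2 _).comp (continuous_pi fun i => ?_)
    fin_cases i <;> simp <;> fun_prop
  have hcH : ContinuousOn (fun p : ℝ × ℝ => H (circlePt p.1 p.2)) (Icc (R₂, -π) (R₁, π)) := by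
    refine hH.continuousOn.comp continuous_circlePt.continuousOn ?_
    rintro p ⟨h1, h2⟩
    exact circlePt_mem_closure R₂ R₁ h0 hR _ _ ⟨h1.1, h2.1⟩
  have hcP := (Phi_cont β hβ x₀).comp continuous_circlePt
  have hcf : ContinuousOn (ff K x₀) (Icc (R₂, -π) (R₁, π)) := by
    rw [funext hfeq]
    exact hcH.mul (hcP.inner continuous_circlePt).continuousOn
  have hcg : ContinuousOn (gg K x₀) (Icc (R₂, -π) (R₁, π)) := by
    rw [funext hgeq]
    exact hcH.mul (hcP.inner (hcQ.comp continuous_snd)).continuousOn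
  have hpt : ∀ p ∈ Ioo R₂ R₁ ×ˢ Ioo (-π) π, DifferentiableAt ℝ (ff K x₀) p ∧
      DifferentiableAt ℝ (gg K x₀) p ∧
      fderiv ℝ (ff K x₀) p (1, 0) + fderiv ℝ (gg K x₀) p (0, 1) =
      p.1 * ((fun x => 2 * (β + 1) * ‖x - x₀‖ ^ (2 * β) * H x
      + ‖x - x₀‖ ^ (2 * β) * fderiv ℝ H x (x - x₀)) (circlePt p.1 p.2)) := by
    intro p hp
    have hn := norm_circlePt p.1 p.2 (h0.trans hp.1.1.le)
    have hm : circlePt p.1 p.2 ∈ ann R₂ R₁ := by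
      simp only [ann, mem_ofPred_eq, hn]; exact hp.1
    have hne : circlePt p.1 p.2 ≠ x₀ := by
      intro h
      rw [h, hx₀] at hn
      have := hp.1.1
      linarith
    have hd : DifferentiableAt ℝ H (circlePt p.1 p.2) :=
      (hH.differentiableOn (by simp)).differentiableAt
        (Filter.mem_of_superset ((ann_isOpen R₂ R₁).mem_nhds hm) subset_closure)
    obtain ⟨K', hK', hK2⟩ := K_deriv β x₀ _ hne H _ hd.hasFDerivAt
    obtain ⟨a, b, c⟩ := polar_div K K' x₀ p hK'
    refine ⟨a, b, ?_⟩
    rw [c, hK2]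
    simp only [hKdef]
    ring
  have hae : (Ioo R₂ R₁ ×ˢ Ioo (-π) π : Set (ℝ × ℝ)) =ᵐ[volume] Icc (R₂, -π) (R₁, π) := by
    rw [← Icc_prod_Icc]
    exact Measure.set_prod_ae_eq Ioo_ae_eq_Icc Ioo_ae_eq_Icc
  have hms : MeasurableSet (Ioo R₂ R₁ ×ˢ Ioo (-π) π : Set (ℝ × ℝ)) :=
    measurableSet_Ioo.prod measurableSet_Ioo
  have hI : IntegrableOn (fun p => fderiv ℝ (ff K x₀) p (1, 0) + fderiv ℝ (gg K x₀) p (0, 1))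
      (Icc (R₂, -π) (R₁, π)) := by
    rw [← integrableOn_congr_set_ae hae]
    exact (polar_integrable R₂ R₁ h0 _ hi).congr_fun (fun p hp => (hpt p hp).2.2.symm) hms
  have main := integral_divergence_prod_Icc_of_hasFDerivAt_of_le (ff K x₀) (gg K x₀)
    (fderiv ℝ (ff K x₀)) (fderiv ℝ (gg K x₀)) (R₂, -π) (R₁, π) ⟨hR.le, hpi.le⟩ hcf hcg
    (fun p hp => (hpt p hp).1.hasFDerivAt) (fun p hp => (hpt p hp).2.1.hasFDerivAt) hI
  rw [polar_int R₂ R₁ h0, ← setIntegral_congr_fun hms (fun p hp => (hpt p hp).2.2),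
    setIntegral_congr_set hae, main]
  have hper : ∀ r : ℝ, ∫ y in (-π)..π, ff K x₀ (r, y) = ∫ y in (0:ℝ)..(2 * π), ff K x₀ (r, y) := by
    intro r
    have hp : Function.Periodic (fun y => ff K x₀ (r, y)) (2 * π) := by
      intro y
      simp [ff, circlePt]
    have := hp.intervalIntegral_add_eq (-π) 0
    rwa [zero_add, show -π + 2 * π = π by ring] at this
  have hgper : ∀ r : ℝ, gg K x₀ (r, π) = gg K x₀ (r, -π) := by
    intro r
    simp [gg, circlePt]
  simp only [hgper, hper, sub_self, zero_add]
  have e1 : ∫ y in (0:ℝ)..(2 * π), ff K x₀ (R₁, y) =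
      circleIntR (fun x => ‖x - x₀‖ ^ (2 * β) * ⟪x - x₀, R₁⁻¹ • x⟫ * H x) R₁ := by
    unfold circleIntR
    congr 1
    funext y
    simp only [hfeq, real_inner_smul_left, real_inner_smul_right]
    have : R₁ ≠ 0 := by linarith
    field_simp
  have e2 : ∫ y in (0:ℝ)..(2 * π), ff K x₀ (R₂, y) =
      - circleIntR (fun x => ‖x - x₀‖ ^ (2 * β) * ⟪x - x₀, -(R₂⁻¹ • x)⟫ * H x) R₂ := by
    unfold circleIntR
    rw [← intervalIntegral.integral_neg]
    congr 1
    funext y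
    simp only [hfeq, real_inner_smul_left, inner_neg_right, real_inner_smul_right]
    have : R₂ ≠ 0 := by linarith
    field_simp
  rw [e1, e2]
  ring

lemma gradient_inner (f : E2 → ℝ) (x v : E2) : ⟪v, gradient f x⟫ = fderiv ℝ f x v := by
  rw [real_inner_comm, gradient, InnerProductSpace.toDual_symm_apply]

/-- Integrability of a weighted product of continuous bounded functions. -/
lemma w_mul_integrable (R₂ R₁ β : ℝ) (hβ : -(1/2) < β) (x₀ : E2) (f : E2 → ℝ) (C : ℝ)
    (hf : ContinuousOn f (ann R₂ R₁)) (hC : ∀ x ∈ ann R₂ R₁, ‖f x‖ ≤ C) :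
    IntegrableOn (fun x => ‖x - x₀‖ ^ (2 * β) * f x) (ann R₂ R₁) := by
  have hm := (ann_isOpen R₂ R₁).measurableSet
  refine Integrable.mul_bdd (c := C) (w_integrable R₂ R₁ β hβ x₀)
    (hf.aestronglyMeasurable hm) ?_
  exact (ae_restrict_iff' hm).2 (Filter.Eventually.of_forall hC)

lemma cont_bdd (R₂ R₁ : ℝ) (f : E2 → ℝ) (hf : ContinuousOn f (closure (ann R₂ R₁))) :
    ∃ C : ℝ, ∀ x ∈ ann R₂ R₁, ‖f x‖ ≤ C := by
  obtain ⟨C, hC⟩ := (ann_compact R₂ R₁).exists_bound_of_continuousOn hf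
  exact ⟨C, fun x hx => hC x (subset_closure hx)⟩

/-- Integrability of the weighted derivative terms. -/
lemma w_deriv_integrable (R₂ R₁ β : ℝ) (hβ : -(1/2) < β) (x₀ : E2) (F G : E2 → ℝ)
    (hF : ContDiffOn ℝ 1 F (closure (ann R₂ R₁))) (hG : ContinuousOn G (closure (ann R₂ R₁))) :
    IntegrableOn (fun x => ‖x - x₀‖ ^ (2 * β) * (fderiv ℝ F x (x - x₀) * G x)) (ann R₂ R₁) := by
  obtain ⟨C, hC⟩ := aux_bdd _ (ann_isOpen R₂ R₁) (ann_compact R₂ R₁) F hF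
  obtain ⟨D, hD⟩ := cont_bdd R₂ R₁ (fun x => ‖x - x₀‖ * G x) (by fun_prop)
  refine w_mul_integrable R₂ R₁ β hβ x₀ _ (C * D) ?_ ?_
  · have h1 : ContinuousOn (fderiv ℝ F) (ann R₂ R₁) :=
      (hF.mono subset_closure).continuousOn_fderiv_of_isOpen (ann_isOpen R₂ R₁) le_rfl
    exact (h1.clm_apply (by fun_prop)).mul (hG.mono subset_closure)
  · intro x hx
    have h1 := (fderiv ℝ F x).le_opNorm (x - x₀)
    have h2 := hD x hx
    have h3 := hC x hx
    rw [norm_mul, norm_norm] at h2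
    rw [norm_mul]
    calc _ ≤ (‖fderiv ℝ F x‖ * ‖x - x₀‖) * ‖G x‖ := by gcongr
      _ = ‖fderiv ℝ F x‖ * (‖x - x₀‖ * ‖G x‖) := by ring
      _ ≤ C * D := by
        have : 0 ≤ C := (norm_nonneg _).trans h3
        gcongr

/-- **Weighted integration by parts for the weight `|x - x₀|^{2β}`** on a sub-annulus
`A = {R₂ < |x| < R₁}` with `1/2 ≤ R₂ < R₁ ≤ 1`, `β ∈ (-1/2, ∞)`, `x₀ ∈ C(1/2)`. -/
theorem weighted_int_by_parts_Pbeta (R₂ R₁ β : ℝ) (hR₂ : 1/2 ≤ R₂) (hR : R₂ < R₁) (hR₁ : R₁ ≤ 1)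
    (hβ : -(1/2) < β) (x₀ : E2) (hx₀ : ‖x₀‖ = 1/2)
    (V u : E2 → ℝ)
    (hV : ContDiffOn ℝ 1 V (closure (ann R₂ R₁)))
    (hu : ContDiffOn ℝ 1 u (closure (ann R₂ R₁))) :
    ∫ x in ann R₂ R₁,
        -(‖x - x₀‖ ^ (2 * β) * V x *
          ⟪x - x₀, gradient (fun y => Real.exp (u y)) x⟫) =
      (∫ x in ann R₂ R₁,
        2 * (β + 1) * ‖x - x₀‖ ^ (2 * β) * V x * Real.exp (u x))
      + (∫ x in ann R₂ R₁,
        ‖x - x₀‖ ^ (2 * β) * ⟪x - x₀, gradient V x⟫ * Real.exp (u x))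
      - (circleIntR (fun x =>
          ‖x - x₀‖ ^ (2 * β) * ⟪x - x₀, R₁⁻¹ • x⟫ * V x * Real.exp (u x)) R₁
        + circleIntR (fun x =>
          ‖x - x₀‖ ^ (2 * β) * ⟪x - x₀, -(R₂⁻¹ • x)⟫ * V x * Real.exp (u x)) R₂) := by
  have hE : ContDiffOn ℝ 1 (fun y => Real.exp (u y)) (closure (ann R₂ R₁)) := hu.exp
  have hH : ContDiffOn ℝ 1 (fun y => V y * Real.exp (u y)) (closure (ann R₂ R₁)) := hV.mul hE
  have hm := (ann_isOpen R₂ R₁).measurableSet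
  have i1 : IntegrableOn (fun x => -(‖x - x₀‖ ^ (2 * β) * V x *
      ⟪x - x₀, gradient (fun y => Real.exp (u y)) x⟫)) (ann R₂ R₁) := by
    refine (w_deriv_integrable R₂ R₁ β hβ x₀ _ _ hE hV.continuousOn).neg.congr_fun ?_ hm
    intro x _
    simp only [gradient_inner, Pi.neg_apply]
    ring
  have i2 : IntegrableOn (fun x => 2 * (β + 1) * ‖x - x₀‖ ^ (2 * β) * V x * Real.exp (u x))
      (ann R₂ R₁) := by
    obtain ⟨C, hC⟩ := cont_bdd R₂ R₁ _ hH.continuousOn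
    have h := (w_mul_integrable R₂ R₁ β hβ x₀ _ C (hH.continuousOn.mono subset_closure)
      hC).const_mul (2 * (β + 1))
    refine IntegrableOn.congr_fun h ?_ hm
    intro x _
    simp only
    ring
  have i3 : IntegrableOn (fun x => ‖x - x₀‖ ^ (2 * β) * ⟪x - x₀, gradient V x⟫ * Real.exp (u x))
      (ann R₂ R₁) := by
    refine (w_deriv_integrable R₂ R₁ β hβ x₀ _ _ hV hE.continuousOn).congr_fun ?_ hm
    intro x _
    simp only [gradient_inner]
    ring
  have hpt : ∀ x ∈ ann R₂ R₁,
      2 * (β + 1) * ‖x - x₀‖ ^ (2 * β) * V x * Real.exp (u x)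
        + ‖x - x₀‖ ^ (2 * β) * ⟪x - x₀, gradient V x⟫ * Real.exp (u x)
        - -(‖x - x₀‖ ^ (2 * β) * V x * ⟪x - x₀, gradient (fun y => Real.exp (u y)) x⟫)
      = 2 * (β + 1) * ‖x - x₀‖ ^ (2 * β) * (V x * Real.exp (u x))
        + ‖x - x₀‖ ^ (2 * β) * fderiv ℝ (fun y => V y * Real.exp (u y)) x (x - x₀) := by
    intro x hx
    have hn : closure (ann R₂ R₁) ∈ nhds x :=
      Filter.mem_of_superset ((ann_isOpen R₂ R₁).mem_nhds hx) subset_closure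
    have dV := (hV.differentiableOn (by simp)).differentiableAt hn
    have dE := (hE.differentiableOn (by simp)).differentiableAt hn
    rw [fderiv_fun_mul dV dE, gradient_inner, gradient_inner]
    simp only [add_apply, smul_apply, smul_eq_mul]
    ring
  have D := div_thm R₂ R₁ β hR₂ hR hβ x₀ hx₀ _ hH
    (((i2.add i3).sub i1).congr_fun hpt hm)
  have i23 : IntegrableOn (fun x => 2 * (β + 1) * ‖x - x₀‖ ^ (2 * β) * V x * Real.exp (u x)
      + ‖x - x₀‖ ^ (2 * β) * ⟪x - x₀, gradient V x⟫ * Real.exp (u x)) (ann R₂ R₁) := i2.add i3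
  rw [← setIntegral_congr_fun hm hpt, integral_sub i23 i1, integral_add i2 i3] at D
  simp only [← mul_assoc] at D
  linarith
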